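/- Let Ω ⊆ ℝ^n be a compact convex set and f : ℝ^n → ℝ differentiable with L-Lipschitz gradient (L > 0). Let μ > 0 and x* ∈ Ω be such that ‖π(T_Ω(x), −∇f(x))‖² ≥ 2μ(f(x) − f(x*)) and f(x) ≥ f(x*) for all x ∈ Ω. Let x_k ∈ Ω, d ∈ ℝ^n with d ≠ 0 and ⟨−∇f(x_k), d⟩ ≥ 0, and let x_{k+1} = x_k + α d with 0 ≤ α ≤ ⟨−∇f(x_k), d⟩/(L‖d‖²). Suppose x_{k+1} is a full Frank-Wolfe step, i.e. ⟨∇f(x_k), x_{k+1}⟩ ≤ ⟨∇f(x_k), y⟩ for all y ∈ Ω. Then f(x_{k+1}) − f(x*) ≤ (1 + μ/L)^{−1}(f(x_k) − f(x*)). -/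

import Mathlib

open Set Metric RealInnerProductSpace

noncomputable section

/-- The tangent cone to a convex set `Ω` at `x`: the closure of the cone of feasible
directions. -/
def tangentCone {n : ℕ} (Ω : Set (EuclideanSpace ℝ (Fin n))) (x : EuclideanSpace ℝ (Fin n)) :
    Set (EuclideanSpace ℝ (Fin n)) :=
  closure {w | ∃ l : ℝ, 0 < l ∧ x + l • w ∈ Ω}

/-- The normal cone to a convex set `Ω` at `x`. -/
def normalCone {n : ℕ} (Ω : Set (EuclideanSpace ℝ (Fin n))) (x : EuclideanSpace ℝ (Fin n)) :
    Set (EuclideanSpace ℝ (Fin n)) :=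
  {v | ∀ y ∈ Ω, ⟪v, y - x⟫ ≤ 0}

/-- `p` is the Euclidean (metric) projection of `g` onto the set `C`. -/
def IsProjection {n : ℕ} (C : Set (EuclideanSpace ℝ (Fin n)))
    (g p : EuclideanSpace ℝ (Fin n)) : Prop :=
  p ∈ C ∧ ∀ w ∈ C, ‖g - p‖ ≤ ‖g - w‖

/-- The descent lemma for a function with Lipschitz gradient. -/
theorem le_add_inner_gradient_add_of_lipschitz_gradient {E : Type*} [NormedAddCommGroup E]
    [InnerProductSpace ℝ E] [CompleteSpace E] {f : E → ℝ} {L : ℝ}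
    (hdiff : ∀ x, DifferentiableAt ℝ f x)
    (hlip : ∀ x y, ‖gradient f x - gradient f y‖ ≤ L * ‖x - y‖) (x v : E) :
    f (x + v) ≤ f x + ⟪gradient f x, v⟫ + L / 2 * ‖v‖ ^ 2 := by
  let h : ℝ → ℝ := fun t ↦ f (x + t • v) - t * ⟪gradient f x, v⟫ - L / 2 * ‖v‖ ^ 2 * t ^ 2
  have hderiv (t : ℝ) : HasDerivAt h
      (⟪gradient f (x + t • v), v⟫ - ⟪gradient f x, v⟫ - L * ‖v‖ ^ 2 * t) t := by
    have hline : HasDerivAt (fun t : ℝ ↦ x + t • v) v t := by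
      simpa using ((hasDerivAt_id t).smul_const v).const_add x
    have hcomp := (hdiff (x + t • v)).hasGradientAt.hasFDerivAt.comp_hasDerivAt t hline
    have hf : HasDerivAt (fun t : ℝ ↦ f (x + t • v)) ⟪gradient f (x + t • v), v⟫ t := by
      simpa [Function.comp_def] using hcomp
    refine ((hf.sub ((hasDerivAt_id t).mul_const ⟪gradient f x, v⟫)).sub
      ((hasDerivAt_pow 2 t).const_mul (L / 2 * ‖v‖ ^ 2))).congr_deriv ?_
    norm_num
    ring
  have hanti : AntitoneOn h (Set.Icc 0 1) := by
    refine antitoneOn_of_deriv_nonpos (convex_Icc 0 1)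
      (fun t _ ↦ (hderiv t).continuousAt.continuousWithinAt)
      (fun t _ ↦ (hderiv t).differentiableAt.differentiableWithinAt) fun t ht ↦ ?_
    rw [interior_Icc] at ht
    have hgrad := hlip (x + t • v) x
    rw [add_sub_cancel_left, norm_smul, Real.norm_eq_abs, abs_of_pos ht.1] at hgrad
    have hinner := (real_inner_le_norm (gradient f (x + t • v) - gradient f x) v).trans
      (mul_le_mul_of_nonneg_right hgrad (norm_nonneg v))
    rw [inner_sub_left] at hinner
    rw [(hderiv t).deriv]
    linarith
  have h01 := hanti (Set.left_mem_Icc.2 zero_le_one) (Set.right_mem_Icc.2 zero_le_one) zero_le_one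
  simp only [h, one_smul, zero_smul, add_zero] at h01
  linarith

theorem smul_mem_tangentCone {n : ℕ} {Ω : Set (EuclideanSpace ℝ (Fin n))}
    {x w : EuclideanSpace ℝ (Fin n)} (hw : w ∈ tangentCone Ω x) {s : ℝ} (hs : 0 < s) :
    s • w ∈ tangentCone Ω x := by
  refine map_mem_closure (continuous_const_smul s) hw ?_
  rintro u ⟨l, hl, hu⟩
  exact ⟨l / s, div_pos hl hs, by rwa [smul_smul, div_mul_cancel₀ l hs.ne']⟩

theorem inner_nonpos_of_mem_normalCone_of_mem_tangentCone {n : ℕ}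
    {Ω : Set (EuclideanSpace ℝ (Fin n))} {x v w : EuclideanSpace ℝ (Fin n)}
    (hv : v ∈ normalCone Ω x) (hw : w ∈ tangentCone Ω x) : ⟪v, w⟫ ≤ 0 := by
  refine closure_minimal (t := {w | ⟪v, w⟫ ≤ 0}) ?_ (isClosed_le (by fun_prop) (by fun_prop)) hw
  rintro u ⟨l, hl, hu⟩
  have h := hv _ hu
  rw [add_sub_cancel_left, real_inner_smul_right] at h
  exact nonpos_of_mul_nonpos_right h hl

theorem IsProjection.norm_sq_le_inner {n : ℕ} {C : Set (EuclideanSpace ℝ (Fin n))}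
    {g p : EuclideanSpace ℝ (Fin n)} (hp : IsProjection C g p)
    (hC : ∀ s : ℝ, 0 < s → s • p ∈ C) : ‖p‖ ^ 2 ≤ ⟪g, p⟫ := by
  by_contra! hlt
  have key (t : ℝ) (ht0 : 0 < t) (ht1 : t < 1) : 2 * (‖p‖ ^ 2 - ⟪g, p⟫) ≤ t * ‖p‖ ^ 2 := by
    have h := pow_le_pow_left₀ (norm_nonneg _) (hp.2 _ (hC (1 - t) (by linarith))) 2
    rw [norm_sub_sq_real, norm_sub_sq_real, real_inner_smul_right, norm_smul, mul_pow,
      Real.norm_eq_abs, sq_abs] at h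
    refine le_of_mul_le_mul_left ?_ ht0
    linarith
  have hlim : Filter.Tendsto (fun t : ℝ ↦ t * ‖p‖ ^ 2) (nhdsWithin 0 (Set.Ioi 0)) (nhds 0) := by
    have h : Continuous fun t : ℝ ↦ t * ‖p‖ ^ 2 := by fun_prop
    simpa using (h.tendsto 0).mono_left nhdsWithin_le_nhds
  have := ge_of_tendsto hlim (b := 2 * (‖p‖ ^ 2 - ⟪g, p⟫)) (by
    filter_upwards [Ioo_mem_nhdsGT (zero_lt_one (α := ℝ))] with t ht
    exact key t ht.1 ht.2)
  linarith

/-- The projection of `g` onto the tangent cone is no longer than the distance from `g` to any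
element of the normal cone. -/
theorem IsProjection.norm_le_norm_sub_of_mem_normalCone {n : ℕ}
    {Ω : Set (EuclideanSpace ℝ (Fin n))} {x g p v : EuclideanSpace ℝ (Fin n)}
    (hp : IsProjection (tangentCone Ω x) g p) (hv : v ∈ normalCone Ω x) : ‖p‖ ≤ ‖g - v‖ := by
  have h1 := hp.norm_sq_le_inner fun _ hs ↦ smul_mem_tangentCone hp.1 hs
  have h2 := inner_nonpos_of_mem_normalCone_of_mem_tangentCone hv hp.1
  have h3 := real_inner_le_norm (g - v) p
  rw [inner_sub_left] at h3
  rcases (norm_nonneg p).eq_or_lt with h0 | h0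
  · rw [← h0]
    exact norm_nonneg _
  · refine le_of_mul_le_mul_right ?_ h0
    linarith

/-- Proposition 3, second part: under the KL inequality, a full
Frank-Wolfe step (with stepsize at most `⟪-∇f(x_k), d⟫/(L‖d‖²)`) contracts the
optimality gap by the factor `(1 + μ/L)⁻¹`. -/
theorem stmt8 {n : ℕ} (Ω : Set (EuclideanSpace ℝ (Fin n)))
    (hΩcp : IsCompact Ω) (hΩconv : Convex ℝ Ω)
    (f : EuclideanSpace ℝ (Fin n) → ℝ) (L : ℝ) (hL : 0 < L)
    (hdiff : ∀ x, DifferentiableAt ℝ f x)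
    (hlip : ∀ x y, ‖gradient f x - gradient f y‖ ≤ L * ‖x - y‖)
    (μ : ℝ) (hμ : 0 < μ)
    (xstar : EuclideanSpace ℝ (Fin n)) (hxstar : xstar ∈ Ω)
    (P : EuclideanSpace ℝ (Fin n) → EuclideanSpace ℝ (Fin n))
    (hP : ∀ x ∈ Ω, IsProjection (tangentCone Ω x) (-gradient f x) (P x))
    (hKL : ∀ x ∈ Ω, 2 * μ * (f x - f xstar) ≤ ‖P x‖ ^ 2)
    (hlb : ∀ x ∈ Ω, f xstar ≤ f x)
    (xk : EuclideanSpace ℝ (Fin n)) (hxk : xk ∈ Ω)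
    (d : EuclideanSpace ℝ (Fin n)) (hd : d ≠ 0) (hdesc : 0 ≤ ⟪-gradient f xk, d⟫)
    (α : ℝ) (hα0 : 0 ≤ α) (hα1 : α ≤ ⟪-gradient f xk, d⟫ / (L * ‖d‖ ^ 2))
    (hfeas : xk + α • d ∈ Ω)
    (hfullFW : ∀ y ∈ Ω, ⟪gradient f xk, xk + α • d⟫ ≤ ⟪gradient f xk, y⟫) :
    f (xk + α • d) - f xstar ≤ (1 + μ / L)⁻¹ * (f xk - f xstar) := by
  have hnormal : -gradient f xk ∈ normalCone Ω (xk + α • d) := fun y hy ↦ by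
    rw [inner_neg_left, inner_sub_right]
    linarith [hfullFW y hy]
  have hproj := (hP _ hfeas).norm_le_norm_sub_of_mem_normalCone hnormal
  have hgrad := hlip xk (xk + α • d)
  rw [sub_add_cancel_left, norm_neg] at hgrad
  rw [neg_sub_neg] at hproj
  have hsq := pow_le_pow_left₀ (norm_nonneg _) (hproj.trans hgrad) 2
  have hgap := (hKL _ hfeas).trans hsq
  have hdescent := le_add_inner_gradient_add_of_lipschitz_gradient hdiff hlip xk (α • d)
  have hstep : L * ‖α • d‖ ^ 2 ≤ -⟪gradient f xk, α • d⟫ := by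
    have hd' : 0 < ‖d‖ := norm_pos_iff.2 hd
    rw [le_div_iff₀ (by positivity), inner_neg_left] at hα1
    have h := mul_le_mul_of_nonneg_left hα1 hα0
    rw [norm_smul, mul_pow, Real.norm_eq_abs, sq_abs, real_inner_smul_right]
    linarith
  have hdecrease : L / 2 * ‖α • d‖ ^ 2 ≤ f xk - f (xk + α • d) := by linarith
  have hμL : μ / L * (f (xk + α • d) - f xstar) ≤ f xk - f (xk + α • d) := by
    refine le_trans ?_ hdecrease
    rw [div_mul_eq_mul_div, div_le_iff₀ hL]
    linarith
  rw [inv_mul_eq_div, le_div_iff₀ (by positivity)]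
  linarith
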